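/- Fix p > 1 and the dyadic partitions. Suppose the Faber–Schauder coefficients satisfy θ_{m,k} = c_m σ_{m,k} with c_m ≥ 0 and σ_{m,k} ∈ {±1} (uniform magnitude condition), and suppose ξ_m := 2^{−mp/2} Σ_{k=0}^{2^m−1} |θ_{m,k}|^p = 2^{m(1−p/2)} c_m^p converges to a limit ξ as m → ∞. Then the Faber–Schauder series x(t) = Σ_{m≥0} Σ_{k∈I_m} θ_{m,k} e_{m,k}(t) defines a (1/p)-Hölder continuous function on [0,1], and there is a constant C_p > 0 depending only on p such that lim_{n→∞} [x]^{(p)}_{𝕋^n}(t) = C_p · t · ξ for every t ∈ [0,1]; explicitly C_p = E[|Σ_{j≥1} 2^{−j(1−1/p)} ε_j|^p] for i.i.d. Rademacher ε_j. -/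

import Mathlib

/-- Discrete p-th variation of `x` along the n-th dyadic partition, stopped at `t`. -/
noncomputable def dyadicPVar (p : ℝ) (x : ℝ → ℝ) (n : ℕ) (t : ℝ) : ℝ :=
  ∑ j ∈ Finset.range (2 ^ n),
    |x (min (((j : ℝ) + 1) / 2 ^ n) t) - x (min ((j : ℝ) / 2 ^ n) t)| ^ p

/-- The Faber–Schauder function `e_{m,k}`, the integral of the Haar function
`ψ_{m,k}`: a tent of slope `±2^{m/2}` supported on `[k/2^m, (k+1)/2^m]`. -/
noncomputable def faberSchauder (m k : ℕ) (t : ℝ) : ℝ :=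
  (2 : ℝ) ^ ((m : ℝ) / 2) *
    max 0 ((2 : ℝ) ^ (-(m : ℝ) - 1) - |t - (2 * (k : ℝ) + 1) / 2 ^ (m + 1)|)

/-- The j-th Rademacher function on `[0,1]`: these form an i.i.d. Rademacher sequence
under Lebesgue measure. -/
noncomputable def radFn (j : ℕ) (t : ℝ) : ℝ :=
  if ⌊(2 : ℝ) ^ j * t⌋ % 2 = 0 then 1 else -1

/-- The constant `C_p = E[|Σ_{j≥1} 2^{−j(1−1/p)} ε_j|^p]`, realized via the Rademacher
functions on `[0,1]` with Lebesgue measure. -/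
noncomputable def CpConst (p : ℝ) : ℝ :=
  ∫ t in (0 : ℝ)..1,
    |∑' j : ℕ, (2 : ℝ) ^ (-((j : ℝ) + 1) * (1 - 1 / p)) * radFn (j + 1) t| ^ p

/-- The `m`-th level of the Faber–Schauder series. -/
noncomputable def fsLevel (θ : ℕ → ℕ → ℝ) (m : ℕ) (t : ℝ) : ℝ :=
  ∑ k ∈ Finset.range (2 ^ m), θ m k * faberSchauder m k t

lemma two_rpow_neg_sub (m : ℕ) : (2 : ℝ) ^ (-(m : ℝ) - 1) = 1 / 2 ^ m / 2 := by
  rw [Real.rpow_sub two_pos, Real.rpow_neg two_pos.le, Real.rpow_natCast, Real.rpow_one]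
  simp

lemma fs_form (m k : ℕ) (t : ℝ) : faberSchauder m k t = (2 : ℝ) ^ ((m : ℝ) / 2) *
    max 0 (1 / 2 ^ m / 2 - |t - (k / 2 ^ m + 1 / 2 ^ m / 2)|) := by
  unfold faberSchauder
  rw [two_rpow_neg_sub]
  congr 5
  rw [pow_succ]
  field_simp

lemma fs_lip (m k : ℕ) (t s : ℝ) :
    |faberSchauder m k t - faberSchauder m k s| ≤ (2 : ℝ) ^ ((m : ℝ) / 2) * |t - s| := by
  rw [fs_form, fs_form, ← mul_sub, abs_mul, abs_of_pos (by positivity)]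
  apply mul_le_mul_of_nonneg_left _ (by positivity)
  set a : ℝ := (k / 2 ^ m + 1 / 2 ^ m / 2)
  have h1 := abs_max_sub_max_le_abs (1 / 2 ^ m / 2 - |t - a|) (1 / 2 ^ m / 2 - |s - a|) 0
  rw [max_comm 0, max_comm 0]
  refine h1.trans ?_
  have h2 := abs_abs_sub_abs_le (s - a) (t - a)
  have h3 : (1 / 2 ^ m / 2 - |t - a|) - (1 / 2 ^ m / 2 - |s - a|) = |s - a| - |t - a| := by ring
  rw [h3, abs_sub_comm t s]
  rw [show s - t = (s - a) - (t - a) by ring]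
  exact h2

lemma fs_zero (m k : ℕ) (t : ℝ) (h : t ≤ k / 2 ^ m ∨ ((k : ℝ) + 1) / 2 ^ m ≤ t) :
    faberSchauder m k t = 0 := by
  rw [fs_form]
  apply mul_eq_zero_of_right
  apply max_eq_left
  have : ((k : ℝ) + 1) / 2 ^ m = k / 2 ^ m + 1 / 2 ^ m := by ring
  rw [this] at h
  have := le_abs_self (t - (k / 2 ^ m + 1 / 2 ^ m / 2))
  have := neg_le_abs (t - (k / 2 ^ m + 1 / 2 ^ m / 2))
  rcases h with h | h <;> linarith

lemma fs_left (m k : ℕ) (t : ℝ) (h : (k : ℝ) / 2 ^ m ≤ t) (h' : t ≤ k / 2 ^ m + 1 / 2 ^ m / 2) :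
    faberSchauder m k t = (2 : ℝ) ^ ((m : ℝ) / 2) * (t - k / 2 ^ m) := by
  rw [fs_form, abs_of_nonpos (by linarith), max_eq_right (by linarith)]
  ring

lemma fs_right (m k : ℕ) (t : ℝ) (h : (k : ℝ) / 2 ^ m + 1 / 2 ^ m / 2 ≤ t)
    (h' : t ≤ k / 2 ^ m + 1 / 2 ^ m) :
    faberSchauder m k t = (2 : ℝ) ^ ((m : ℝ) / 2) * (k / 2 ^ m + 1 / 2 ^ m - t) := by
  rw [fs_form, abs_of_nonneg (by linarith), max_eq_right (by linarith)]
  ring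

lemma fs_bound (m k : ℕ) (t : ℝ) :
    |faberSchauder m k t| ≤ (2 : ℝ) ^ ((m : ℝ) / 2) * (1 / 2 ^ m) := by
  rw [fs_form, abs_mul, abs_of_pos (by positivity : (0:ℝ) < 2 ^ ((m : ℝ) / 2))]
  gcongr
  have : (0:ℝ) < 1 / 2 ^ m := by positivity
  have := abs_nonneg (t - (k / 2 ^ m + 1 / 2 ^ m / 2))
  rw [abs_of_nonneg (le_max_left _ _)]
  apply max_le <;> linarith

lemma fs_other (m k k' : ℕ) (hk : k ≠ k') (t : ℝ) (h : (k : ℝ) / 2 ^ m ≤ t)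
    (h' : t ≤ ((k : ℝ) + 1) / 2 ^ m) : faberSchauder m k' t = 0 := by
  apply fs_zero
  rcases lt_or_gt_of_ne hk with hlt | hlt
  · left
    refine h'.trans ?_
    gcongr
    exact_mod_cast hlt
  · right
    refine le_trans ?_ h
    gcongr
    exact_mod_cast hlt

lemma fsLevel_block (θ : ℕ → ℕ → ℝ) (m k : ℕ) (hk : k < 2 ^ m) (t : ℝ) (h : (k : ℝ) / 2 ^ m ≤ t)
    (h' : t ≤ ((k : ℝ) + 1) / 2 ^ m) : fsLevel θ m t = θ m k * faberSchauder m k t := by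
  unfold fsLevel
  apply Finset.sum_eq_single k
  · intro b _ hb
    rw [fs_other m k b hb.symm t h h', mul_zero]
  · intro h
    exact absurd (Finset.mem_range.2 hk) h

lemma exists_block (m : ℕ) (t : ℝ) (ht : t ∈ Set.Icc (0 : ℝ) 1) :
    ∃ k : ℕ, k < 2 ^ m ∧ (k : ℝ) / 2 ^ m ≤ t ∧ t ≤ ((k : ℝ) + 1) / 2 ^ m := by
  have h2 : (0 : ℝ) < 2 ^ m := by positivity
  rcases eq_or_lt_of_le ht.2 with h1 | h1
  · have h3 : 1 ≤ 2 ^ m := Nat.one_le_two_pow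
    refine ⟨2 ^ m - 1, by omega, ?_, ?_⟩
    · rw [div_le_iff₀ h2, h1]
      push_cast [Nat.cast_sub h3]
      linarith
    · rw [le_div_iff₀ h2, h1]
      push_cast [Nat.cast_sub h3]
      linarith
  · have h4 : 0 ≤ t * 2 ^ m := mul_nonneg ht.1 h2.le
    refine ⟨⌊t * 2 ^ m⌋₊, ?_, ?_, ?_⟩
    · rw [Nat.floor_lt h4]
      push_cast
      nlinarith
    · rw [div_le_iff₀ h2]
      exact Nat.floor_le h4
    · rw [le_div_iff₀ h2]
      exact (Nat.lt_floor_add_one _).le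

lemma fsLevel_bound (θ : ℕ → ℕ → ℝ) (m : ℕ) (c : ℝ) (hθ : ∀ k, |θ m k| = c)
    (t : ℝ) (ht : t ∈ Set.Icc (0 : ℝ) 1) :
    |fsLevel θ m t| ≤ c * (2 : ℝ) ^ ((m : ℝ) / 2) * (1 / 2 ^ m) := by
  obtain ⟨k, hk, h1, h2⟩ := exists_block m t ht
  rw [fsLevel_block θ m k hk t h1 h2, abs_mul, hθ, mul_assoc]
  have hc : 0 ≤ c := hθ 0 ▸ abs_nonneg _
  gcongr
  exact fs_bound m k t

lemma fsLevel_lip (θ : ℕ → ℕ → ℝ) (m : ℕ) (c : ℝ) (hθ : ∀ k, |θ m k| = c)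
    (t s : ℝ) (ht : t ∈ Set.Icc (0 : ℝ) 1) (hs : s ∈ Set.Icc (0 : ℝ) 1) :
    |fsLevel θ m t - fsLevel θ m s| ≤ 2 * (c * (2 : ℝ) ^ ((m : ℝ) / 2) * |t - s|) := by
  have hc : 0 ≤ c := hθ 0 ▸ abs_nonneg _
  obtain ⟨k, hk, h1, h2⟩ := exists_block m t ht
  obtain ⟨k', hk', h1', h2'⟩ := exists_block m s hs
  rw [fsLevel_block θ m k hk t h1 h2, fsLevel_block θ m k' hk' s h1' h2']
  have key : ∀ k, |θ m k * (faberSchauder m k t - faberSchauder m k s)| ≤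
      c * (2 : ℝ) ^ ((m : ℝ) / 2) * |t - s| := by
    intro k
    rw [abs_mul, hθ, mul_assoc]
    gcongr
    exact fs_lip m k t s
  by_cases hkk : k = k'
  · subst hkk
    rw [← mul_sub]
    have := key k
    have : 0 ≤ c * (2 : ℝ) ^ ((m : ℝ) / 2) * |t - s| := by positivity
    linarith [key k]
  · have e1 := fs_other m k k' hkk t h1 h2
    have e2 := fs_other m k' k (Ne.symm hkk) s h1' h2'
    have : θ m k * faberSchauder m k t - θ m k' * faberSchauder m k' s =
      θ m k * (faberSchauder m k t - faberSchauder m k s) +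
      θ m k' * (faberSchauder m k' t - faberSchauder m k' s) := by
      rw [e1, e2]; ring
    rw [this]
    refine (abs_add_le _ _).trans ?_
    linarith [key k, key k']

/-- sign of a bit -/
noncomputable def bsgn (j : ℕ) : ℝ := if j % 2 = 0 then 1 else -1

lemma fsLevel_dyadic_zero (θ : ℕ → ℕ → ℝ) (m n j : ℕ) (hmn : n ≤ m) :
    fsLevel θ m ((j : ℝ) / 2 ^ n) = 0 := by
  obtain ⟨i, rfl⟩ := Nat.exists_eq_add_of_le hmn
  unfold fsLevel
  apply Finset.sum_eq_zero
  intro k _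
  rw [fs_zero, mul_zero]
  have : (j : ℝ) / 2 ^ n = ((j * 2 ^ i : ℕ) : ℝ) / 2 ^ (n + i) := by
    push_cast
    rw [pow_add]
    field_simp
  rw [this]
  rcases le_or_gt (j * 2 ^ i) k with h | h
  · left
    gcongr
  · right
    gcongr
    exact_mod_cast h

lemma fsLevel_incr (θ : ℕ → ℕ → ℝ) (n l j : ℕ) (hl : l < n) (hj : j < 2 ^ n) :
    fsLevel θ (n - 1 - l) (((j : ℝ) + 1) / 2 ^ n) - fsLevel θ (n - 1 - l) ((j : ℝ) / 2 ^ n) =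
      (2 : ℝ) ^ (((n - 1 - l : ℕ) : ℝ) / 2) * (1 / 2 ^ n) *
        (θ (n - 1 - l) (j / 2 ^ (l + 1)) * bsgn (j / 2 ^ l)) := by
  obtain ⟨m, rfl⟩ : ∃ m, n = m + (l + 1) := ⟨n - (l + 1), by omega⟩
  have e : m + (l + 1) - 1 - l = m := by omega
  rw [e]
  set k := j / 2 ^ (l + 1) with hk
  have hP : 0 < 2 ^ (l + 1) := by positivity
  have hP' : 0 < 2 ^ l := by positivity
  have hk1 : k < 2 ^ m := by
    rw [hk, Nat.div_lt_iff_lt_mul hP, ← pow_add]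
    exact hj
  have hk2 : k = (j / 2 ^ l) / 2 := by
    rw [hk, pow_succ, Nat.div_div_eq_div_mul]
  set b := j / 2 ^ l with hb
  have hb1 : b * 2 ^ l ≤ j := Nat.div_mul_le_self _ _
  have hb2 : j + 1 ≤ (b + 1) * 2 ^ l := by
    have := Nat.lt_div_mul_add hP' (a := j)
    rw [← hb] at this
    rw [add_mul, one_mul]
    omega
  have hb1r : (b : ℝ) * 2 ^ l ≤ j := by exact_mod_cast hb1
  have hb2r : (j : ℝ) + 1 ≤ (b + 1) * 2 ^ l := by exact_mod_cast hb2
  have hA : (0 : ℝ) < 2 ^ m := by positivity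
  have hB : (0 : ℝ) < 2 ^ l := by positivity
  have hpow : (2 : ℝ) ^ (m + (l + 1)) = 2 ^ m * (2 * 2 ^ l) := by
    rw [pow_add, pow_succ]; ring
  have lo : (b : ℝ) / 2 / 2 ^ m ≤ j / 2 ^ (m + (l + 1)) := by
    rw [hpow, div_div, div_le_div_iff₀ (by positivity) (by positivity)]
    have := mul_le_mul_of_nonneg_left hb1r (by positivity : (0:ℝ) ≤ 2 * 2 ^ m)
    linarith
  have hi : ((j : ℝ) + 1) / 2 ^ (m + (l + 1)) ≤ ((b : ℝ) + 1) / 2 / 2 ^ m := by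
    rw [hpow, div_div, div_le_div_iff₀ (by positivity) (by positivity)]
    have := mul_le_mul_of_nonneg_left hb2r (by positivity : (0:ℝ) ≤ 2 * 2 ^ m)
    linarith
  have stp : ((j : ℝ) + 1) / 2 ^ (m + (l + 1)) = j / 2 ^ (m + (l + 1)) + 1 / 2 ^ (m + (l + 1)) := by
    ring
  have stp0 : (0 : ℝ) < 1 / 2 ^ (m + (l + 1)) := by positivity
  have hhalf : (0 : ℝ) < 1 / 2 ^ m := by positivity
  have ekk : ((k : ℝ) + 1) / 2 ^ m = k / 2 ^ m + 1 / 2 ^ m := by ring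
  rcases Nat.mod_two_eq_zero_or_one b with hm | hm
  · have hbk : b = 2 * k := by omega
    have hbr : (b : ℝ) = 2 * k := by exact_mod_cast hbk
    have e1 : (b : ℝ) / 2 / 2 ^ m = k / 2 ^ m := by rw [hbr]; ring
    have e2 : ((b : ℝ) + 1) / 2 / 2 ^ m = k / 2 ^ m + 1 / 2 ^ m / 2 := by rw [hbr]; ring
    rw [e1] at lo
    rw [e2] at hi
    rw [fsLevel_block θ m k hk1 _ (by linarith) (by linarith),
      fsLevel_block θ m k hk1 _ (by linarith) (by linarith),
      fs_left m k _ (by linarith) (by linarith), fs_left m k _ (by linarith) (by linarith), stp]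
    simp only [bsgn, hm, if_true]
    ring
  · have hbk : b = 2 * k + 1 := by omega
    have hbr : (b : ℝ) = 2 * k + 1 := by exact_mod_cast hbk
    have e1 : (b : ℝ) / 2 / 2 ^ m = k / 2 ^ m + 1 / 2 ^ m / 2 := by rw [hbr]; ring
    have e2 : ((b : ℝ) + 1) / 2 / 2 ^ m = k / 2 ^ m + 1 / 2 ^ m := by rw [hbr]; ring
    rw [e1] at lo
    rw [e2] at hi
    rw [fsLevel_block θ m k hk1 _ (by linarith) (by linarith),
      fsLevel_block θ m k hk1 _ (by linarith) (by linarith),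
      fs_right m k _ (by linarith) (by linarith), fs_right m k _ (by linarith) (by linarith), stp]
    simp only [bsgn, hm, one_ne_zero, if_false]
    ring

/-- Sum of `G` over all sign choices. -/
noncomputable def sgnSum (G : ℝ → ℝ) : ℕ → (ℕ → ℝ) → ℝ → ℝ
  | 0, _, u => G u
  | L + 1, w, u => sgnSum G L (fun i => w (i + 1)) (u + w 0) +
      sgnSum G L (fun i => w (i + 1)) (u - w 0)

lemma sgnSum_succ (G : ℝ → ℝ) (L : ℕ) (w : ℕ → ℝ) (u : ℝ) :
    sgnSum G (L + 1) w u = sgnSum G L w (u + w L) + sgnSum G L w (u - w L) := by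
  induction L generalizing w u with
  | zero => rfl
  | succ L ih =>
    rw [sgnSum, ih, ih, sgnSum, sgnSum]
    rw [show u + w 0 + w (L + 1) = u + w (L + 1) + w 0 by ring,
      show u + w 0 - w (L + 1) = u - w (L + 1) + w 0 by ring,
      show u - w 0 + w (L + 1) = u + w (L + 1) - w 0 by ring,
      show u - w 0 - w (L + 1) = u - w (L + 1) - w 0 by ring]
    ring

lemma sgnSum_ge (G : ℝ → ℝ) (hG : ∀ u a, 2 * G u ≤ G (u + a) + G (u - a))
    (L : ℕ) (w : ℕ → ℝ) (u : ℝ) : 2 ^ L * G u ≤ sgnSum G L w u := by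
  induction L generalizing w u with
  | zero => simp [sgnSum]
  | succ L ih =>
    rw [sgnSum]
    have h1 := ih (fun i => w (i + 1)) (u + w 0)
    have h2 := ih (fun i => w (i + 1)) (u - w 0)
    have := mul_le_mul_of_nonneg_left (hG u (w 0)) (by positivity : (0:ℝ) ≤ 2 ^ L)
    rw [pow_succ]
    linarith

lemma block_sum (G : ℝ → ℝ) (τ : ℕ → ℕ → ℝ) (hτ : ∀ l k, τ l k = 1 ∨ τ l k = -1)
    (w : ℕ → ℝ) (L q : ℕ) (u : ℝ) :
    ∑ i ∈ Finset.range (2 ^ L), G (u + ∑ l ∈ Finset.range L,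
      w l * (τ l ((q * 2 ^ L + i) / 2 ^ (l + 1)) * bsgn ((q * 2 ^ L + i) / 2 ^ l))) =
    sgnSum G L w u := by
  induction L generalizing q u with
  | zero => simp [sgnSum]
  | succ L ih =>
    rw [pow_succ, mul_two, Finset.sum_range_add, sgnSum_succ]
    have hP : 0 < 2 ^ L := by positivity
    have f1 : ∀ i ∈ Finset.range (2 ^ L), G (u + ∑ l ∈ Finset.range (L + 1),
        w l * (τ l ((q * (2 ^ L + 2 ^ L) + i) / 2 ^ (l + 1)) *
          bsgn ((q * (2 ^ L + 2 ^ L) + i) / 2 ^ l))) =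
        G ((u + w L * τ L q) + ∑ l ∈ Finset.range L,
          w l * (τ l (((2 * q) * 2 ^ L + i) / 2 ^ (l + 1)) *
          bsgn (((2 * q) * 2 ^ L + i) / 2 ^ l))) := by
      intro i hi
      have hi' := Finset.mem_range.1 hi
      have e : q * (2 ^ L + 2 ^ L) + i = (2 * q) * 2 ^ L + i := by ring
      rw [e, Finset.sum_range_succ]
      have e1 : ((2 * q) * 2 ^ L + i) / 2 ^ L = 2 * q := by
        rw [mul_comm, Nat.mul_add_div hP, Nat.div_eq_of_lt hi', add_zero]
      have e2 : ((2 * q) * 2 ^ L + i) / 2 ^ (L + 1) = q := by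
        rw [pow_succ, ← Nat.div_div_eq_div_mul, e1]; omega
      rw [e1, e2]
      have : bsgn (2 * q) = 1 := by simp [bsgn]
      rw [this]
      congr 1
      ring
    have f2 : ∀ i ∈ Finset.range (2 ^ L), G (u + ∑ l ∈ Finset.range (L + 1),
        w l * (τ l ((q * (2 ^ L + 2 ^ L) + (2 ^ L + i)) / 2 ^ (l + 1)) *
          bsgn ((q * (2 ^ L + 2 ^ L) + (2 ^ L + i)) / 2 ^ l))) =
        G ((u - w L * τ L q) + ∑ l ∈ Finset.range L,
          w l * (τ l (((2 * q + 1) * 2 ^ L + i) / 2 ^ (l + 1)) *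
          bsgn (((2 * q + 1) * 2 ^ L + i) / 2 ^ l))) := by
      intro i hi
      have hi' := Finset.mem_range.1 hi
      have e : q * (2 ^ L + 2 ^ L) + (2 ^ L + i) = (2 * q + 1) * 2 ^ L + i := by ring
      rw [e, Finset.sum_range_succ]
      have e1 : ((2 * q + 1) * 2 ^ L + i) / 2 ^ L = 2 * q + 1 := by
        rw [mul_comm, Nat.mul_add_div hP, Nat.div_eq_of_lt hi', add_zero]
      have e2 : ((2 * q + 1) * 2 ^ L + i) / 2 ^ (L + 1) = q := by
        rw [pow_succ, ← Nat.div_div_eq_div_mul, e1]; omega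
      rw [e1, e2]
      have : bsgn (2 * q + 1) = -1 := by
        unfold bsgn; rw [if_neg (by omega)]
      rw [this]
      congr 1
      ring
    rw [Finset.sum_congr rfl f1, Finset.sum_congr rfl f2, ih, ih]
    rcases hτ L q with h | h <;> rw [h]
    · simp
    · rw [add_comm]; simp [sub_eq_add_neg]

lemma measurable_radFn (j : ℕ) : Measurable (radFn j) := by
  unfold radFn
  refine Measurable.ite ?_ measurable_const measurable_const
  have : Measurable (fun t : ℝ => ⌊(2 : ℝ) ^ j * t⌋) :=
    Int.measurable_floor.comp (measurable_const_mul _)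
  exact this (MeasurableSet.of_discrete (s := {z : ℤ | z % 2 = 0}))

lemma abs_radFn (j : ℕ) (t : ℝ) : |radFn j t| = 1 := by
  unfold radFn
  split_ifs <;> simp

lemma radFn_succ (j : ℕ) (t : ℝ) : radFn (j + 1) t = radFn j (2 * t) := by
  unfold radFn
  rw [pow_succ, mul_assoc]

lemma radFn_sub_one (j : ℕ) (t : ℝ) : radFn (j + 1) (t - 1) = radFn (j + 1) t := by
  unfold radFn
  have : (2 : ℝ) ^ (j + 1) * (t - 1) = (2 : ℝ) ^ (j + 1) * t - ((2 ^ (j + 1) : ℤ) : ℝ) := by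
    push_cast; ring
  rw [this, Int.floor_sub_intCast]
  have h : (⌊(2 : ℝ) ^ (j + 1) * t⌋ - 2 ^ (j + 1)) % 2 = ⌊(2 : ℝ) ^ (j + 1) * t⌋ % 2 := by
    rw [pow_succ]; omega
  rw [h]

lemma radFn_one_left (t : ℝ) (h0 : 0 < t) (h1 : t < 1 / 2) : radFn 1 t = 1 := by
  unfold radFn
  have : ⌊(2 : ℝ) ^ 1 * t⌋ = 0 := by
    rw [Int.floor_eq_iff]; constructor <;> norm_num <;> linarith
  rw [this]; simp

lemma radFn_one_right (t : ℝ) (h0 : 1 / 2 < t) (h1 : t < 1) : radFn 1 t = -1 := by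
  unfold radFn
  have : ⌊(2 : ℝ) ^ 1 * t⌋ = 1 := by
    rw [Int.floor_eq_iff]; constructor <;> norm_num <;> linarith
  rw [this]; simp

lemma rad_partial_measurable (G : ℝ → ℝ) (hG : Continuous G) (L : ℕ) (w : ℕ → ℝ) (u : ℝ) :
    Measurable (fun t => G (u + ∑ l ∈ Finset.range L, w l * radFn (l + 1) t)) := by
  apply hG.measurable.comp
  apply Measurable.const_add
  apply Finset.measurable_fun_sum
  intro i _
  exact (measurable_radFn _).const_mul _

lemma rad_partial_bound (L : ℕ) (w : ℕ → ℝ) (u t : ℝ) :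
    |u + ∑ l ∈ Finset.range L, w l * radFn (l + 1) t| ≤ |u| + ∑ l ∈ Finset.range L, |w l| := by
  refine (abs_add_le _ _).trans ?_
  gcongr
  refine (Finset.abs_sum_le_sum_abs _ _).trans ?_
  refine Finset.sum_le_sum fun i _ => ?_
  rw [abs_mul, abs_radFn, mul_one]

lemma rad_partial_integrable (G : ℝ → ℝ) (hG : Continuous G) (L : ℕ) (w : ℕ → ℝ) (u a b : ℝ) :
    IntervalIntegrable (fun t => G (u + ∑ l ∈ Finset.range L, w l * radFn (l + 1) t))
      MeasureTheory.volume a b := by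
  obtain ⟨K, hK⟩ := (isCompact_Icc (a := -(|u| + ∑ l ∈ Finset.range L, |w l|))
    (b := |u| + ∑ l ∈ Finset.range L, |w l|)).exists_bound_of_continuousOn hG.continuousOn
  apply (intervalIntegrable_const (c := K)).mono_fun
  · exact (rad_partial_measurable G hG L w u).aestronglyMeasurable
  · refine Filter.Eventually.of_forall fun t => ?_
    refine (hK _ (abs_le.1 (rad_partial_bound L w u t))).trans (le_abs_self _)

lemma interval_congr_Ioo {a b : ℝ} (hab : a ≤ b) {f g : ℝ → ℝ}
    (h : ∀ t ∈ Set.Ioo a b, f t = g t) : ∫ t in a..b, f t = ∫ t in a..b, g t := by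
  rw [intervalIntegral.integral_of_le hab, intervalIntegral.integral_of_le hab,
    MeasureTheory.integral_Ioc_eq_integral_Ioo, MeasureTheory.integral_Ioc_eq_integral_Ioo]
  exact MeasureTheory.setIntegral_congr_fun measurableSet_Ioo h

lemma rad_integral (G : ℝ → ℝ) (hG : Continuous G) (L : ℕ) (w : ℕ → ℝ) (u : ℝ) :
    2 ^ L * ∫ t in (0:ℝ)..1, G (u + ∑ l ∈ Finset.range L, w l * radFn (l + 1) t) =
      sgnSum G L w u := by
  induction L generalizing w u with
  | zero => simp [sgnSum]
  | succ L ih =>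
    rw [sgnSum, ← ih, ← ih]
    rw [← intervalIntegral.integral_add_adjacent_intervals (b := 1 / 2)
      (rad_partial_integrable G hG _ w u _ _) (rad_partial_integrable G hG _ w u _ _)]
    set w' : ℕ → ℝ := fun i => w (i + 1) with hw'
    have i1 : ∫ t in (0:ℝ)..(1/2), G (u + ∑ l ∈ Finset.range (L + 1), w l * radFn (l + 1) t) =
        ∫ t in (0:ℝ)..(1/2), (fun y => G (u + w 0 + ∑ l ∈ Finset.range L, w' l * radFn (l + 1) y))
          (2 * t) := by
      apply interval_congr_Ioo (by norm_num)
      intro t ht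
      simp only
      rw [Finset.sum_range_succ', radFn_one_left t ht.1 ht.2]
      simp only [radFn_succ (_ + 1), hw']
      congr 1
      ring
    have i2 : ∫ t in (1/2:ℝ)..1, G (u + ∑ l ∈ Finset.range (L + 1), w l * radFn (l + 1) t) =
        ∫ t in (1/2:ℝ)..1, (fun y => G (u - w 0 + ∑ l ∈ Finset.range L, w' l * radFn (l + 1) y))
          (2 * t - 1) := by
      apply interval_congr_Ioo (by norm_num)
      intro t ht
      simp only
      rw [Finset.sum_range_succ', radFn_one_right t ht.1 ht.2]
      simp only [radFn_sub_one, radFn_succ (_ + 1), hw']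
      congr 1
      ring
    rw [i1, i2, intervalIntegral.integral_comp_mul_left (fun y => G (u + w 0 + ∑ l ∈ Finset.range L, w' l * radFn (l + 1) y)) two_ne_zero,
      intervalIntegral.integral_comp_mul_sub (fun y => G (u - w 0 + ∑ l ∈ Finset.range L, w' l * radFn (l + 1) y)) two_ne_zero, pow_succ]
    norm_num
    ring

lemma geo_sum_le (r : ℝ) (h0 : 0 < r) (h1 : r < 1) (n : ℕ) :
    ∑ l ∈ Finset.range n, r ^ (l + 1) ≤ r / (1 - r) := by
  have : ∑ l ∈ Finset.range n, r ^ (l + 1) = r * ∑ l ∈ Finset.range n, r ^ l := by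
    rw [Finset.mul_sum]
    exact Finset.sum_congr rfl fun i _ => by ring
  rw [this, div_eq_mul_inv, ← tsum_geometric_of_lt_one h0.le h1]
  gcongr
  exact (summable_geometric_of_lt_one h0.le h1).sum_le_tsum _ (fun i _ => by positivity)

lemma r_bounds (p : ℝ) (hp : 1 < p) :
    0 < (2 : ℝ) ^ (-(1 - 1 / p)) ∧ (2 : ℝ) ^ (-(1 - 1 / p)) < 1 := by
  refine ⟨by positivity, ?_⟩
  apply Real.rpow_lt_one_of_one_lt_of_neg one_lt_two
  have : 1 / p < 1 := by rw [div_lt_one (by linarith)]; exact hp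
  linarith

lemma continuous_abs_rpow (p : ℝ) (hp : 1 < p) : Continuous (fun y : ℝ => |y| ^ p) :=
  continuous_abs.rpow_const fun _ => Or.inr (by linarith)

lemma sgnSum_tendsto (p : ℝ) (hp : 1 < p) :
    Filter.Tendsto (fun L : ℕ => sgnSum (fun y => |y| ^ p) L
      (fun l => ((2 : ℝ) ^ (-(1 - 1 / p))) ^ (l + 1)) 0 / 2 ^ L) Filter.atTop
      (nhds (CpConst p)) := by
  obtain ⟨hr0, hr1⟩ := r_bounds p hp
  have hre : ∀ j : ℕ, (2 : ℝ) ^ (-((j : ℝ) + 1) * (1 - 1 / p)) =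
      ((2 : ℝ) ^ (-(1 - 1 / p))) ^ (j + 1) := by
    intro j
    rw [← Real.rpow_natCast, ← Real.rpow_mul two_pos.le]
    congr 1
    push_cast
    ring
  unfold CpConst
  simp_rw [hre]
  set r := (2 : ℝ) ^ (-(1 - 1 / p))
  have hG := continuous_abs_rpow p hp
  have e : ∀ L : ℕ, sgnSum (fun y => |y| ^ p) L (fun l => r ^ (l + 1)) 0 / 2 ^ L =
      ∫ t in (0:ℝ)..1, |∑ l ∈ Finset.range L, r ^ (l + 1) * radFn (l + 1) t| ^ p := by
    intro L
    rw [← rad_integral _ hG, mul_div_cancel_left₀ _ (by positivity)]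
    simp
  simp_rw [e]
  apply intervalIntegral.tendsto_integral_filter_of_dominated_convergence
    (fun _ => (r / (1 - r)) ^ p)
  · refine Filter.Eventually.of_forall fun L => ?_
    have := (rad_partial_measurable _ hG L (fun l => r ^ (l + 1)) 0).aestronglyMeasurable
      (μ := MeasureTheory.volume.restrict (Set.uIoc (0:ℝ) 1))
    simpa using this
  · refine Filter.Eventually.of_forall fun L => Filter.Eventually.of_forall fun t _ => ?_
    rw [Real.norm_of_nonneg (by positivity)]
    apply Real.rpow_le_rpow (abs_nonneg _) _ (by linarith)
    refine (Finset.abs_sum_le_sum_abs _ _).trans ((le_of_eq ?_).trans (geo_sum_le r hr0 hr1 L))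
    refine Finset.sum_congr rfl fun i _ => ?_
    rw [abs_mul, abs_radFn, mul_one, abs_of_pos (by positivity)]
  · exact intervalIntegrable_const
  · refine Filter.Eventually.of_forall fun t _ => ?_
    have hs : Summable (fun l : ℕ => r ^ (l + 1) * radFn (l + 1) t) := by
      apply Summable.of_norm_bounded (g := fun l : ℕ => r ^ (l + 1))
      · exact (summable_nat_add_iff 1).2 (summable_geometric_of_lt_one hr0.le hr1)
      · intro i
        rw [Real.norm_eq_abs, abs_mul, abs_radFn, mul_one, abs_of_pos (by positivity)]
    exact (hG.tendsto _).comp hs.hasSum.tendsto_sum_nat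

lemma abs_rpow_midpoint (p : ℝ) (hp : 1 < p) (u a : ℝ) :
    2 * |u| ^ p ≤ |u + a| ^ p + |u - a| ^ p := by
  have hc0 := (convexOn_rpow hp.le).2
  have hc := hc0 (Set.mem_Ici.2 (abs_nonneg (u + a))) (Set.mem_Ici.2 (abs_nonneg (u - a)))
    (by norm_num : (0 : ℝ) ≤ 1 / 2) (by norm_num : (0 : ℝ) ≤ 1 / 2) (by norm_num)
  simp only [smul_eq_mul] at hc
  have h1 : |u| ≤ 1 / 2 * |u + a| + 1 / 2 * |u - a| := by
    have := abs_add_le (u + a) (u - a)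
    rw [show u + a + (u - a) = 2 * u by ring, abs_mul, abs_two] at this
    linarith
  have h2 := Real.rpow_le_rpow (abs_nonneg u) h1 (by linarith : 0 ≤ p)
  linarith

lemma CpConst_pos (p : ℝ) (hp : 1 < p) : 0 < CpConst p := by
  obtain ⟨hr0, hr1⟩ := r_bounds p hp
  have h := (Filter.tendsto_add_atTop_iff_nat 1).2 (sgnSum_tendsto p hp)
  set r := (2 : ℝ) ^ (-(1 - 1 / p))
  refine lt_of_lt_of_le (Real.rpow_pos_of_pos hr0 p) (ge_of_tendsto' h fun L => ?_)
  rw [sgnSum, le_div_iff₀ (by positivity)]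
  have h1 := sgnSum_ge (fun y => |y| ^ p) (abs_rpow_midpoint p hp) L
    (fun i => r ^ (i + 1 + 1)) (0 + r ^ (0 + 1))
  have h2 := sgnSum_ge (fun y => |y| ^ p) (abs_rpow_midpoint p hp) L
    (fun i => r ^ (i + 1 + 1)) (0 - r ^ (0 + 1))
  simp only [zero_add, zero_sub, pow_one, abs_neg, abs_of_pos hr0] at h1 h2 ⊢
  rw [pow_succ]
  linarith

set_option maxHeartbeats 1000000 in
lemma holder_sum (p B r w : ℝ) (hp : 1 < p) (hB : 0 ≤ B) (hr0 : 0 < r) (hr1 : r < 1)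
    (hw : w = (1 / 2 : ℝ) ^ (1 / p)) (hrw : r * w = 1 / 2) (X : ℕ → ℝ → ℝ)
    (hb : ∀ m, ∀ t ∈ Set.Icc (0 : ℝ) 1, |X m t| ≤ B * w ^ m)
    (hl : ∀ m, ∀ t ∈ Set.Icc (0 : ℝ) 1, ∀ s ∈ Set.Icc (0 : ℝ) 1,
      |X m t - X m s| ≤ 2 * (B * r⁻¹ ^ m * |t - s|)) :
    ∃ C : ℝ, 0 ≤ C ∧ ∀ s ∈ Set.Icc (0 : ℝ) 1, ∀ t ∈ Set.Icc (0 : ℝ) 1,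
      |(∑' m : ℕ, X m t) - (∑' m : ℕ, X m s)| ≤ C * |t - s| ^ (1 / p) := by
  have hp0 : 0 < p := by linarith
  have hw0 : 0 < w := by rw [hw]; positivity
  have hw1 : w < 1 := by
    rw [hw]
    exact Real.rpow_lt_one (by norm_num) (by norm_num) (by positivity)
  have hsw := summable_geometric_of_lt_one hw0.le hw1
  have hsX : ∀ t ∈ Set.Icc (0 : ℝ) 1, Summable fun m => X m t := fun t ht =>
    Summable.of_norm_bounded (hsw.mul_left B) fun m => hb m t ht
  have h1r : 0 < 1 - r := by linarith
  have h1w : 0 < 1 - w := by linarith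
  refine ⟨2 * B / (w * (1 - r)) + 2 * B / (1 - w), by positivity, ?_⟩
  intro s hs t ht
  rcases eq_or_ne t s with rfl | hts
  · simp only [sub_self, abs_zero]
    positivity
  have hh0 : 0 < |t - s| := abs_pos.2 (sub_ne_zero.2 hts)
  have hh1 : |t - s| ≤ 1 := by
    rw [abs_le]; constructor <;> linarith [ht.1, ht.2, hs.1, hs.2]
  obtain ⟨N, hN1, hN2⟩ := exists_nat_pow_near_of_lt_one hh0 hh1
    (by norm_num : (0:ℝ) < 1 / 2) (by norm_num)
  set h := |t - s|
  have hwN : w ^ (N + 1) ≤ h ^ (1 / p) := by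
    have : w ^ (N + 1) = ((1 / 2 : ℝ) ^ (N + 1)) ^ (1 / p) := by
      rw [hw, ← Real.rpow_natCast, ← Real.rpow_natCast, ← Real.rpow_mul (by norm_num),
        ← Real.rpow_mul (by norm_num), mul_comm]
    rw [this]
    exact Real.rpow_le_rpow (by positivity) hN1.le (by positivity)
  rw [← (hsX t ht).tsum_sub (hsX s hs)]
  have hfb : ∀ m, |X m t - X m s| ≤ 2 * B * w ^ m := by
    intro m
    refine (abs_sub _ _).trans ?_
    linarith [hb m t ht, hb m s hs]
  have hsf : Summable fun m => |X m t - X m s| :=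
    Summable.of_nonneg_of_le (fun _ => abs_nonneg _) hfb (hsw.mul_left (2 * B))
  refine (norm_tsum_le_tsum_norm (f := fun m => X m t - X m s) hsf).trans ?_
  simp only [Real.norm_eq_abs]
  rw [← hsf.sum_add_tsum_nat_add (N + 1)]
  have p1 : ∑ m ∈ Finset.range (N + 1), |X m t - X m s| ≤ 2 * B * w ^ N * (1 - r)⁻¹ := by
    have q1 : ∑ m ∈ Finset.range (N + 1), |X m t - X m s| ≤
        ∑ m ∈ Finset.range (N + 1), 2 * B * w ^ N * r ^ (N + 1 - 1 - m) := by
      refine Finset.sum_le_sum fun m hm => ?_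
      have hm' : m ≤ N := by have := Finset.mem_range.1 hm; omega
      obtain ⟨i, rfl⟩ := Nat.exists_eq_add_of_le hm'
      refine (hl m t ht s hs).trans ?_
      have e1 : m + i + 1 - 1 - m = i := by omega
      rw [e1]
      have e2 : (r⁻¹ ^ m) * (1 / 2 : ℝ) ^ (m + i) = w ^ (m + i) * r ^ i := by
        rw [← hrw, mul_pow, inv_pow, pow_add r]
        field_simp
      calc 2 * (B * r⁻¹ ^ m * h) ≤ 2 * (B * r⁻¹ ^ m * (1 / 2 : ℝ) ^ (m + i)) := by gcongr
        _ = 2 * B * ((r⁻¹ ^ m) * (1 / 2 : ℝ) ^ (m + i)) := by ring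
        _ = _ := by rw [e2]; ring
    refine q1.trans ?_
    rw [Finset.sum_range_reflect (fun i => 2 * B * w ^ N * r ^ i) (N + 1), ← Finset.mul_sum,
      ← tsum_geometric_of_lt_one hr0.le hr1]
    gcongr
    exact (summable_geometric_of_lt_one hr0.le hr1).sum_le_tsum _ (fun i _ => by positivity)
  have p2 : ∑' m, |X (m + (N + 1)) t - X (m + (N + 1)) s| ≤ 2 * B * w ^ (N + 1) * (1 - w)⁻¹ := by
    rw [← tsum_geometric_of_lt_one hw0.le hw1, ← tsum_mul_left]
    refine Summable.tsum_le_tsum (fun m => ?_) ((summable_nat_add_iff (N + 1)).2 hsf)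
      (hsw.mul_left _)
    refine (hfb _).trans (le_of_eq ?_)
    ring
  calc _ ≤ 2 * B * w ^ N * (1 - r)⁻¹ + 2 * B * w ^ (N + 1) * (1 - w)⁻¹ := add_le_add p1 p2
    _ = (2 * B / (w * (1 - r)) + 2 * B / (1 - w)) * w ^ (N + 1) := by
        rw [pow_succ, add_mul]
        congr 1
        · field_simp
        · rw [div_eq_mul_inv]; ring
    _ ≤ _ := mul_le_mul_of_nonneg_left hwN (by positivity)

lemma abs_bsgn (j : ℕ) : |bsgn j| = 1 := by
  unfold bsgn
  split_ifs <;> simp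

lemma block_avg (T : ℕ → ℝ) (P : ℕ) (hP : 0 < P) (V K : ℝ) (hT : ∀ j, |T j| ≤ K)
    (hV : ∀ q, ∑ i ∈ Finset.range P, T (q * P + i) = V) (N : ℕ) :
    |∑ j ∈ Finset.range N, T j - N * (V / P)| ≤ 2 * P * K := by
  have hK : 0 ≤ K := (abs_nonneg _).trans (hT 0)
  have hPr : (0 : ℝ) < P := by exact_mod_cast hP
  have h1 : ∀ q : ℕ, ∑ j ∈ Finset.range (q * P), T j = q * V := by
    intro q
    induction q with
    | zero => simp
    | succ q ih =>
      rw [add_mul, one_mul, Finset.sum_range_add, ih, hV]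
      push_cast
      ring
  have h2 : ∀ a i : ℕ, |∑ j ∈ Finset.range i, T (a + j)| ≤ i * K := by
    intro a i
    refine (Finset.abs_sum_le_sum_abs _ _).trans ?_
    refine (Finset.sum_le_sum fun j _ => hT (a + j)).trans ?_
    simp
  have hVb : |V| ≤ P * K := by
    rw [← hV 0]; exact h2 _ _
  set q := N / P
  set i := N % P
  have hN : N = q * P + i := by rw [mul_comm]; exact (Nat.div_add_mod N P).symm
  have hi : i < P := Nat.mod_lt _ hP
  have hir : (i : ℝ) ≤ P := by exact_mod_cast hi.le
  rw [hN, Finset.sum_range_add, h1]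
  have e : (q * V + ∑ j ∈ Finset.range i, T (q * P + j)) - ((q * P + i : ℕ) : ℝ) * (V / P) =
      ∑ j ∈ Finset.range i, T (q * P + j) - (i / P) * V := by
    push_cast
    field_simp
    ring
  rw [e]
  refine (abs_sub _ _).trans ?_
  have a1 := h2 (q * P) i
  have a2 : (i : ℝ) * K ≤ P * K := by gcongr
  have a3 : |(i / P : ℝ) * V| ≤ P * K := by
    rw [abs_mul, abs_of_nonneg (by positivity)]
    have : (i / P : ℝ) ≤ 1 := by rw [div_le_one hPr]; exact hir
    calc (i / P : ℝ) * |V| ≤ 1 * |V| := by gcongr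
      _ ≤ _ := by linarith
  linarith

lemma main_limit (p : ℝ) (hp : 1 < p) (r : ℝ) (hr0 : 0 < r) (hr1 : r < 1) (d : ℕ → ℝ) (D Cp : ℝ)
    (hd : Filter.Tendsto d Filter.atTop (nhds D))
    (σ : ℕ → ℕ → ℝ) (hσ : ∀ m k, σ m k = 1 ∨ σ m k = -1)
    (hE : Filter.Tendsto (fun L : ℕ => sgnSum (fun y => |y| ^ p) L
      (fun l => r ^ (l + 1)) 0 / 2 ^ L) Filter.atTop (nhds Cp))
    (t : ℝ) (ht : t ∈ Set.Icc (0 : ℝ) 1) :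
    Filter.Tendsto (fun n : ℕ => (1 / 2 ^ n) * ∑ j ∈ Finset.range ⌊2 ^ n * t⌋₊,
      |∑ l ∈ Finset.range n, d (n - 1 - l) * r ^ (l + 1) *
        (σ (n - 1 - l) (j / 2 ^ (l + 1)) * bsgn (j / 2 ^ l))| ^ p)
      Filter.atTop (nhds (|D| ^ p * Cp * t)) := by
  have hp0 : 0 < p := by linarith
  have h1r : 0 < 1 - r := by linarith
  obtain ⟨B, hB⟩ := hd.abs.bddAbove_range
  have hB : ∀ m, |d m| ≤ B := fun m => hB ⟨m, rfl⟩
  have hDB : |D| ≤ B := le_of_tendsto' hd.abs hB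
  have hB0 : 0 ≤ B := (abs_nonneg _).trans hDB
  have hs : ∀ n l j : ℕ, |σ (n - 1 - l) (j / 2 ^ (l + 1)) * bsgn (j / 2 ^ l)| = 1 := by
    intro n l j
    rw [abs_mul, abs_bsgn, mul_one]
    rcases hσ (n - 1 - l) (j / 2 ^ (l + 1)) with h | h <;> simp [h]
  set R := r / (1 - r) with hR
  have hR0 : 0 < R := by positivity
  have hG := continuous_abs_rpow p hp
  -- generic bound
  have gb : ∀ (b : ℝ) (hb : 0 ≤ b) (a : ℕ → ℝ) (n k : ℕ) (s : ℕ → ℝ),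
      (∀ l < k, |a l| ≤ b) → (∀ l, |s l| = 1) →
      |∑ l ∈ Finset.range k, a l * r ^ (l + 1) * s l| ≤ b * R := by
    intro b hb a n k s ha hs1
    refine (Finset.abs_sum_le_sum_abs _ _).trans ?_
    calc ∑ l ∈ Finset.range k, |a l * r ^ (l + 1) * s l|
        ≤ ∑ l ∈ Finset.range k, b * r ^ (l + 1) := by
          refine Finset.sum_le_sum fun l hl => ?_
          rw [abs_mul, hs1, mul_one, abs_mul, abs_of_pos (by positivity : 0 < r ^ (l + 1))]
          have := ha l (Finset.mem_range.1 hl)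
          gcongr
      _ = b * ∑ l ∈ Finset.range k, r ^ (l + 1) := by rw [Finset.mul_sum]
      _ ≤ b * R := by
          gcongr
          exact geo_sum_le r hr0 hr1 k
  rw [Metric.tendsto_atTop']
  intro ε hε
  have huc := (isCompact_Icc (a := -(B * R)) (b := B * R)).uniformContinuousOn_of_continuous
    hG.continuousOn
  rw [Metric.uniformContinuousOn_iff] at huc
  obtain ⟨η, hη, huc⟩ := huc (ε / 4) (by positivity)
  have hL1 : ∀ᶠ L : ℕ in Filter.atTop, B * r ^ L * R < η / 2 := by
    have : Filter.Tendsto (fun L : ℕ => B * r ^ L * R) Filter.atTop (nhds (B * 0 * R)) :=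
      ((tendsto_pow_atTop_nhds_zero_of_lt_one hr0.le hr1).const_mul B).mul_const R
    rw [mul_zero, zero_mul] at this
    exact this.eventually_lt_const (by positivity)
  have hL2 : ∀ᶠ L : ℕ in Filter.atTop, |(|D| ^ p * (sgnSum (fun y => |y| ^ p) L
      (fun l => r ^ (l + 1)) 0 / 2 ^ L) - |D| ^ p * Cp)| < ε / 4 := by
    have := (hE.const_mul (|D| ^ p))
    rw [Metric.tendsto_nhds] at this
    exact this (ε / 4) (by positivity)
  obtain ⟨L, hL1, hL2⟩ := (hL1.and hL2).exists
  set V := sgnSum (fun y => |y| ^ p) L (fun l => r ^ (l + 1)) 0 with hV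
  set v := |D| ^ p * (V / 2 ^ L) with hv
  set K := (B * R) ^ p with hK
  have hn0 : ∀ᶠ m in Filter.atTop, |d m - D| < η / 2 / R := by
    rw [Metric.tendsto_nhds] at hd
    exact hd _ (by positivity)
  obtain ⟨n0, hn0⟩ := Filter.eventually_atTop.1 hn0
  have hn1 : ∀ᶠ n : ℕ in Filter.atTop, (2 * 2 ^ L * K + |v|) * (1 / 2 : ℝ) ^ n < ε / 4 := by
    have := (tendsto_pow_atTop_nhds_zero_of_lt_one (r := (1 / 2 : ℝ)) (by norm_num)
      (by norm_num)).const_mul (2 * 2 ^ L * K + |v|)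
    rw [mul_zero] at this
    exact this.eventually_lt_const (by positivity)
  obtain ⟨n1, hn1⟩ := Filter.eventually_atTop.1 hn1
  refine ⟨n0 + L + n1, fun n hn => ?_⟩
  have hn1 := hn1 n (by omega)
  set N := ⌊2 ^ n * t⌋₊ with hN
  have h2n : (0 : ℝ) < 2 ^ n := by positivity
  have h2t : 0 ≤ 2 ^ n * t := mul_nonneg h2n.le ht.1
  have hNle : (N : ℝ) ≤ 2 ^ n * t := Nat.floor_le h2t
  have hNlt : 2 ^ n * t < N + 1 := Nat.lt_floor_add_one _
  set s : ℕ → ℕ → ℝ := fun j l => σ (n - 1 - l) (j / 2 ^ (l + 1)) * bsgn (j / 2 ^ l) with hsd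
  set S : ℕ → ℝ := fun j => ∑ l ∈ Finset.range n, d (n - 1 - l) * r ^ (l + 1) * s j l with hS
  set T : ℕ → ℝ := fun j => ∑ l ∈ Finset.range L, D * r ^ (l + 1) * s j l with hTd
  have hs1 : ∀ j l, |s j l| = 1 := fun j l => hs n l j
  have hSb : ∀ j, |S j| ≤ B * R := fun j =>
    gb B hB0 (fun l => d (n - 1 - l)) n n (s j) (fun l _ => hB _) (hs1 j)
  have hTb : ∀ j, |T j| ≤ B * R := fun j =>
    gb B hB0 (fun l => D) n L (s j) (fun l _ => hDB) (hs1 j)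
  have hST : ∀ j, |S j - T j| < η := by
    intro j
    obtain ⟨k, hk⟩ : ∃ k, n = L + k := ⟨n - L, by omega⟩
    have e : S j - T j = ∑ l ∈ Finset.range L, (d (n - 1 - l) - D) * r ^ (l + 1) * s j l +
        r ^ L * ∑ i ∈ Finset.range k, d (n - 1 - (L + i)) * r ^ (i + 1) * s j (L + i) := by
      simp only [hS, hTd]
      have : Finset.range n = Finset.range (L + k) := by rw [hk]
      rw [this, Finset.sum_range_add, add_sub_right_comm, ← Finset.sum_sub_distrib, Finset.mul_sum]
      congr 1
      · exact Finset.sum_congr rfl fun l _ => by ring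
      · refine Finset.sum_congr rfl fun l _ => ?_
        rw [show L + l + 1 = L + (l + 1) by ring, pow_add]
        ring
    rw [e]
    refine (abs_add_le _ _).trans_lt ?_
    have a1 := gb (η / 2 / R) (by positivity) (fun l => d (n - 1 - l) - D) n L (s j)
      (fun l hl => (hn0 _ (by omega)).le) (hs1 j)
    have a2 := gb B hB0 (fun i => d (n - 1 - (L + i))) n k (fun i => s j (L + i))
      (fun l _ => hB _) (fun i => hs1 j _)
    rw [div_mul_cancel₀ _ hR0.ne'] at a1
    rw [abs_mul, abs_of_pos (by positivity : 0 < r ^ L)]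
    have a3 := mul_le_mul_of_nonneg_left a2 (by positivity : 0 ≤ r ^ L)
    have a4 : r ^ L * (B * R) = B * r ^ L * R := by ring
    linarith
  have hdiff : ∀ j, |(|S j| ^ p - |T j| ^ p)| ≤ ε / 4 := fun j =>
    (huc (S j) (abs_le.1 (hSb j)) (T j) (abs_le.1 (hTb j)) (hST j)).le
  have step1 : |∑ j ∈ Finset.range N, |S j| ^ p - ∑ j ∈ Finset.range N, |T j| ^ p| ≤
      N * (ε / 4) := by
    rw [← Finset.sum_sub_distrib]
    refine (Finset.abs_sum_le_sum_abs _ _).trans ?_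
    refine (Finset.sum_le_sum fun j _ => hdiff j).trans ?_
    simp
  have step2 : |∑ j ∈ Finset.range N, |T j| ^ p - N * v| ≤ 2 * 2 ^ L * K := by
    have := block_avg (fun j => |T j| ^ p) (2 ^ L) (by positivity) (|D| ^ p * V) K ?_ ?_ N
    · push_cast at this
      rw [hv, ← mul_div_assoc]
      exact this
    · intro j
      rw [abs_of_nonneg (by positivity)]
      exact Real.rpow_le_rpow (abs_nonneg _) (hTb j) hp0.le
    · intro q
      have := block_sum (fun y => |y| ^ p) (fun l k => σ (n - 1 - l) k) (fun l k => hσ _ k)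
        (fun l => r ^ (l + 1)) L q 0
      rw [hV, ← this, Finset.mul_sum]
      refine Finset.sum_congr rfl fun i _ => ?_
      rw [← Real.mul_rpow (abs_nonneg _) (abs_nonneg _), ← abs_mul, zero_add, Finset.mul_sum]
      simp only [hTd, hsd]
      congr 2
      exact Finset.sum_congr rfl fun l _ => by ring
  have step3 : |N * v - 2 ^ n * t * v| ≤ |v| := by
    rw [← sub_mul, abs_mul]
    have : |(N : ℝ) - 2 ^ n * t| ≤ 1 := by rw [abs_le]; constructor <;> linarith
    calc _ ≤ 1 * |v| := by gcongr
      _ = _ := one_mul _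
  have step4 : |t * v - |D| ^ p * Cp * t| ≤ ε / 4 := by
    rw [show t * v - |D| ^ p * Cp * t = t * (v - |D| ^ p * Cp) by ring, abs_mul,
      abs_of_nonneg ht.1]
    calc t * |v - |D| ^ p * Cp| ≤ 1 * (ε / 4) := by
          apply mul_le_mul ht.2 hL2.le (abs_nonneg _) zero_le_one
      _ = _ := one_mul _
  have hNe : (N : ℝ) * (ε / 4) ≤ 2 ^ n * (ε / 4) := by
    have : (N : ℝ) ≤ 2 ^ n := hNle.trans (by nlinarith [ht.2])
    gcongr
  have tot : |∑ j ∈ Finset.range N, |S j| ^ p - 2 ^ n * (t * v)| ≤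
      2 ^ n * (ε / 4) + (2 * 2 ^ L * K + |v|) := by
    rw [← mul_assoc]
    have := abs_sub_le (∑ j ∈ Finset.range N, |S j| ^ p) (∑ j ∈ Finset.range N, |T j| ^ p)
      (2 ^ n * t * v)
    have := abs_sub_le (∑ j ∈ Finset.range N, |T j| ^ p) (N * v) (2 ^ n * t * v)
    linarith
  have fin : |1 / 2 ^ n * ∑ j ∈ Finset.range N, |S j| ^ p - t * v| ≤
      ε / 4 + (2 * 2 ^ L * K + |v|) * (1 / 2 : ℝ) ^ n := by
    have e1 : 1 / 2 ^ n * ∑ j ∈ Finset.range N, |S j| ^ p - t * v =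
        1 / 2 ^ n * (∑ j ∈ Finset.range N, |S j| ^ p - 2 ^ n * (t * v)) := by
      field_simp
    rw [e1, abs_mul, abs_of_pos (by positivity)]
    calc _ ≤ 1 / 2 ^ n * (2 ^ n * (ε / 4) + (2 * 2 ^ L * K + |v|)) := by gcongr
      _ = _ := by rw [one_div_pow]; field_simp
  rw [Real.dist_eq]
  have := abs_sub_le (1 / 2 ^ n * ∑ j ∈ Finset.range N, |S j| ^ p) (t * v) (|D| ^ p * Cp * t)
  linarith

lemma pvar_split (p : ℝ) (hp : 1 < p) (x : ℝ → ℝ) (C : ℝ) (hC : 0 ≤ C)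
    (hx : ∀ s ∈ Set.Icc (0 : ℝ) 1, ∀ t ∈ Set.Icc (0 : ℝ) 1, |x t - x s| ≤ C * |t - s| ^ (1 / p))
    (t : ℝ) (ht : t ∈ Set.Icc (0 : ℝ) 1) (n : ℕ) :
    |dyadicPVar p x n t - ∑ j ∈ Finset.range ⌊2 ^ n * t⌋₊,
      |x (((j : ℝ) + 1) / 2 ^ n) - x ((j : ℝ) / 2 ^ n)| ^ p| ≤ C ^ p * (1 / 2) ^ n := by
  have hp0 : 0 < p := by linarith
  have h2n : (0 : ℝ) < 2 ^ n := by positivity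
  have h2t : 0 ≤ 2 ^ n * t := mul_nonneg h2n.le ht.1
  have hNle : ((⌊2 ^ n * t⌋₊ : ℕ) : ℝ) ≤ 2 ^ n * t := Nat.floor_le h2t
  have hNlt : 2 ^ n * t < ((⌊2 ^ n * t⌋₊ : ℕ) : ℝ) + 1 := Nat.lt_floor_add_one _
  set N := ⌊2 ^ n * t⌋₊ with hN
  have hNM : N ≤ 2 ^ n := by
    have : (N : ℝ) ≤ 2 ^ n := hNle.trans (by nlinarith [ht.2])
    exact_mod_cast this
  unfold dyadicPVar
  rw [← Finset.sum_range_add_sum_Ico _ hNM]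
  have e1 : ∀ j ∈ Finset.range N,
      |x (min (((j : ℝ) + 1) / 2 ^ n) t) - x (min ((j : ℝ) / 2 ^ n) t)| ^ p =
      |x (((j : ℝ) + 1) / 2 ^ n) - x ((j : ℝ) / 2 ^ n)| ^ p := by
    intro j hj
    have hj' : (j : ℝ) + 1 ≤ N := by exact_mod_cast Finset.mem_range.1 hj
    rw [min_eq_left, min_eq_left]
    · rw [div_le_iff₀ h2n]; linarith
    · rw [div_le_iff₀ h2n]; linarith
  rw [Finset.sum_congr rfl e1, add_sub_cancel_left]
  rcases hNM.eq_or_lt with h | h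
  · rw [h]; simp; positivity
  · rw [Finset.sum_eq_sum_Ico_succ_bot h, Finset.sum_eq_zero (s := Finset.Ico (N + 1) (2 ^ n)),
      add_zero, abs_of_nonneg (by positivity)]
    · have hm : (N : ℝ) / 2 ^ n ≤ t := by rw [div_le_iff₀ h2n]; linarith
      have hm' : t ≤ ((N : ℝ) + 1) / 2 ^ n := by rw [le_div_iff₀ h2n]; linarith
      rw [min_eq_right hm', min_eq_left hm]
      have b1 := hx ((N : ℝ) / 2 ^ n) ⟨by positivity, hm.trans ht.2⟩ t ht
      have b2 : |t - (N : ℝ) / 2 ^ n| ≤ (1 / 2) ^ n := by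
        rw [abs_of_nonneg (by linarith), one_div_pow]
        have : ((N : ℝ) + 1) / 2 ^ n = N / 2 ^ n + 1 / 2 ^ n := by ring
        linarith
      calc _ ≤ (C * ((1 / 2 : ℝ) ^ n) ^ (1 / p)) ^ p := by
            apply Real.rpow_le_rpow (abs_nonneg _) _ hp0.le
            refine b1.trans ?_
            gcongr
        _ = _ := by
            rw [Real.mul_rpow hC (by positivity), ← Real.rpow_mul (by positivity),
              one_div_mul_cancel hp0.ne', Real.rpow_one]
    · intro j hj
      have hj' : (N : ℝ) + 1 ≤ j := by exact_mod_cast (Finset.mem_Ico.1 hj).1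
      rw [min_eq_right, min_eq_right]
      · simp [hp0.ne']
      · rw [le_div_iff₀ h2n]; linarith
      · rw [le_div_iff₀ h2n]; linarith

/-- under the uniform magnitude condition `θ_{m,k} = c_m σ_{m,k}` and
convergence `ξ_m = 2^{−mp/2} Σ_k |θ_{m,k}|^p → ξ`, the Faber–Schauder series defines a
(1/p)-Hölder function whose dyadic p-th variation is `C_p · t · ξ`, with
`C_p = E[|Σ_{j≥1} 2^{−j(1−1/p)} ε_j|^p] > 0` for i.i.d. Rademacher `ε_j`. -/
theorem stmt15 (p : ℝ) (hp : 1 < p)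
    (θ : ℕ → ℕ → ℝ) (c : ℕ → ℝ) (σ : ℕ → ℕ → ℝ)
    (hc : ∀ m, 0 ≤ c m) (hσ : ∀ m k, σ m k = 1 ∨ σ m k = -1)
    (hθ : ∀ m k, θ m k = c m * σ m k)
    (ξ : ℝ)
    (hξ : Filter.Tendsto
      (fun m : ℕ => (2 : ℝ) ^ (-(m : ℝ) * p / 2) * ∑ k ∈ Finset.range (2 ^ m), |θ m k| ^ p)
      Filter.atTop (nhds ξ)) :
    (∃ C : ℝ, ∀ s ∈ Set.Icc (0 : ℝ) 1, ∀ t ∈ Set.Icc (0 : ℝ) 1,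
      |(∑' m : ℕ, ∑ k ∈ Finset.range (2 ^ m), θ m k * faberSchauder m k t) -
        (∑' m : ℕ, ∑ k ∈ Finset.range (2 ^ m), θ m k * faberSchauder m k s)|
          ≤ C * |t - s| ^ (1 / p)) ∧
    0 < CpConst p ∧
    ∀ t ∈ Set.Icc (0 : ℝ) 1,
      Filter.Tendsto
        (fun n => dyadicPVar p
          (fun u => ∑' m : ℕ, ∑ k ∈ Finset.range (2 ^ m), θ m k * faberSchauder m k u)
          n t)
        Filter.atTop (nhds (CpConst p * t * ξ)) := by
  have hp0 : 0 < p := by linarith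
  obtain ⟨hr0, hr1⟩ := r_bounds p hp
  have hCp := sgnSum_tendsto p hp
  set r : ℝ := (2 : ℝ) ^ (-(1 - 1 / p)) with hr
  set w : ℝ := (1 / 2 : ℝ) ^ (1 / p) with hw
  have hw0 : 0 < w := by positivity
  have hrw : r * w = 1 / 2 := by
    rw [hr, hw, one_div (2 : ℝ), Real.inv_rpow two_pos.le, ← Real.rpow_neg two_pos.le,
      ← Real.rpow_add two_pos, show -(1 - 1 / p) + -(1 / p) = -1 by ring, Real.rpow_neg_one]
  have hwp : ∀ n : ℕ, (w ^ n) ^ p = 1 / 2 ^ n := by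
    intro n
    rw [hw, ← Real.rpow_natCast, ← Real.rpow_mul (by norm_num : (0 : ℝ) ≤ 1 / 2),
      ← Real.rpow_mul (by norm_num : (0 : ℝ) ≤ 1 / 2), show 1 / p * n * p = n by field_simp, Real.rpow_natCast, one_div_pow]
  have hθabs : ∀ m k, |θ m k| = c m := by
    intro m k
    rw [hθ, abs_mul, abs_of_nonneg (hc m)]
    rcases hσ m k with h | h <;> simp [h]
  set d : ℕ → ℝ := fun m => c m * (2 : ℝ) ^ ((m : ℝ) / 2) * r ^ m with hd
  have hd0 : ∀ m, 0 ≤ d m := fun m => by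
    have := hc m
    positivity
  have hdξ : ∀ m : ℕ, (2 : ℝ) ^ (-(m : ℝ) * p / 2) * ∑ k ∈ Finset.range (2 ^ m), |θ m k| ^ p =
      d m ^ p := by
    intro m
    simp only [hθabs, Finset.sum_const, Finset.card_range, nsmul_eq_mul, hd]
    rw [Real.mul_rpow (mul_nonneg (hc m) (by positivity)) (by positivity),
      Real.mul_rpow (hc m) (by positivity), hr, ← Real.rpow_natCast, ← Real.rpow_mul two_pos.le,
      ← Real.rpow_mul two_pos.le, ← Real.rpow_mul two_pos.le, mul_assoc (c m ^ p),
      ← Real.rpow_add two_pos, mul_comm (c m ^ p), ← mul_assoc]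
    congr 1
    push_cast
    rw [← Real.rpow_natCast 2 m, ← Real.rpow_add two_pos]
    congr 1
    field_simp
    ring
  simp_rw [hdξ] at hξ
  have hξ0 : 0 ≤ ξ := ge_of_tendsto' hξ fun m => Real.rpow_nonneg (hd0 m) p
  have hdD : Filter.Tendsto d Filter.atTop (nhds (ξ ^ (1 / p))) := by
    have := hξ.rpow_const (p := 1 / p) (Or.inr (by positivity))
    refine this.congr fun m => ?_
    rw [← Real.rpow_mul (hd0 m), mul_one_div_cancel hp0.ne', Real.rpow_one]
  have hDp : |ξ ^ (1 / p)| ^ p = ξ := by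
    rw [abs_of_nonneg (by positivity), ← Real.rpow_mul hξ0, one_div_mul_cancel hp0.ne',
      Real.rpow_one]
  obtain ⟨B, hB⟩ := hdD.bddAbove_range
  have hB : ∀ m, d m ≤ B := fun m => hB ⟨m, rfl⟩
  have hB0 : 0 ≤ B := (hd0 0).trans (hB 0)
  obtain ⟨C, hC0, hC⟩ := holder_sum p B r w hp hB0 hr0 hr1 hw hrw (fsLevel θ)
    (by
      intro m t ht
      refine (fsLevel_bound θ m (c m) (hθabs m) t ht).trans ?_
      have e : c m * (2 : ℝ) ^ ((m : ℝ) / 2) * (1 / 2 ^ m) = d m * w ^ m := by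
        rw [← one_div_pow, ← hrw, mul_pow]; simp only [hd]; ring
      rw [e]
      exact mul_le_mul_of_nonneg_right (hB m) (by positivity))
    (by
      intro m t ht s hs
      refine (fsLevel_lip θ m (c m) (hθabs m) t s ht hs).trans ?_
      have e : c m * (2 : ℝ) ^ ((m : ℝ) / 2) = d m * r⁻¹ ^ m := by
        simp only [hd]
        rw [mul_assoc _ (r ^ m), ← mul_pow, mul_inv_cancel₀ hr0.ne', one_pow, mul_one]
      rw [e]
      have := hB m
      gcongr)
  refine ⟨⟨C, hC⟩, CpConst_pos p hp, ?_⟩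
  intro t ht
  change Filter.Tendsto (fun n => dyadicPVar p (fun u => ∑' m : ℕ, fsLevel θ m u) n t) _ _
  have hincr : ∀ n j : ℕ, j < 2 ^ n →
      |(∑' m : ℕ, fsLevel θ m (((j : ℝ) + 1) / 2 ^ n)) - ∑' m : ℕ, fsLevel θ m ((j : ℝ) / 2 ^ n)| ^ p
      = 1 / 2 ^ n * |∑ l ∈ Finset.range n, d (n - 1 - l) * r ^ (l + 1) *
        (σ (n - 1 - l) (j / 2 ^ (l + 1)) * bsgn (j / 2 ^ l))| ^ p := by
    intro n j hj
    have z : ∀ i : ℕ, ∑' m : ℕ, fsLevel θ m ((i : ℝ) / 2 ^ n) =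
        ∑ m ∈ Finset.range n, fsLevel θ m ((i : ℝ) / 2 ^ n) := fun i =>
      tsum_eq_sum fun m hm => fsLevel_dyadic_zero θ m n i (by simpa using hm)
    have z1 := z (j + 1)
    push_cast at z1
    rw [z1, z j, ← Finset.sum_sub_distrib, ← Finset.sum_range_reflect, ← hwp,
      ← Real.mul_rpow (by positivity) (abs_nonneg _)]
    congr 1
    rw [← abs_of_pos (by positivity : 0 < w ^ n), ← abs_mul,
      Finset.mul_sum]
    congr 1
    refine Finset.sum_congr rfl fun l hl => ?_
    have hl' := Finset.mem_range.1 hl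
    rw [fsLevel_incr θ n l j hl' hj, hθ, ← one_div_pow, ← hrw, mul_pow]
    have e : r ^ n = r ^ (n - 1 - l) * r ^ (l + 1) := by
      rw [← pow_add]; congr 1; omega
    rw [e]
    simp only [hd]
    ring
  have hmain := main_limit p hp r hr0 hr1 d _ _ hdD σ hσ hCp t ht
  rw [hDp] at hmain
  rw [show CpConst p * t * ξ = ξ * CpConst p * t by ring]
  have hz : Filter.Tendsto (fun n : ℕ => C ^ p * (1 / 2 : ℝ) ^ n) Filter.atTop (nhds 0) := by
    have := (tendsto_pow_atTop_nhds_zero_of_lt_one (r := (1 / 2 : ℝ)) (by norm_num)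
      (by norm_num)).const_mul (C ^ p)
    rwa [mul_zero] at this
  have hdiff := squeeze_zero_norm
    (f := fun n => dyadicPVar p (fun u => ∑' m : ℕ, fsLevel θ m u) n t -
      ∑ j ∈ Finset.range ⌊2 ^ n * t⌋₊, |(∑' m : ℕ, fsLevel θ m (((j : ℝ) + 1) / 2 ^ n)) -
        ∑' m : ℕ, fsLevel θ m ((j : ℝ) / 2 ^ n)| ^ p)
    (fun n => pvar_split p hp (fun u => ∑' m : ℕ, fsLevel θ m u) C hC0 hC t ht n) hz
  have := hdiff.add hmain
  rw [zero_add] at this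
  refine this.congr fun n => ?_
  rw [Finset.mul_sum, Finset.sum_congr rfl (fun j hj => hincr n j ?_)]
  · ring
  · have h1 := Finset.mem_range.1 hj
    have h2 : ((⌊2 ^ n * t⌋₊ : ℕ) : ℝ) ≤ 2 ^ n * t :=
      Nat.floor_le (mul_nonneg (by positivity) ht.1)
    have h3 : (2 : ℝ) ^ n * t ≤ 2 ^ n := mul_le_of_le_one_right (by positivity) ht.2
    have h4 : ⌊2 ^ n * t⌋₊ ≤ 2 ^ n := by exact_mod_cast h2.trans h3
    omega
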